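/- Let λ, λ' ∈ 𝔫*, and let μ and μ' be the restrictions of λ and λ' to 𝔰̄_λ. Then μ' lies in the right S̄_λ-orbit μ·S̄_λ in (𝔰̄_λ)* if and only if λ' ∈ λ·S̄_λ; and when this holds, Ind_{S̄_λ}^G(ψ_{μ'}) = ψ_{λ'} (where ψ_{μ'} is the Kirillov function of the algebra group S̄_λ attached to μ'), and consequently ⟨ξ_λ, ψ_{λ'}⟩_G is a positive integer. -/

import Mathlib

open scoped Classical BigOperators ComplexOrder

set_option linter.unusedSectionVars false
set_option linter.unusedVariables false

noncomputable section

namespace IterChar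

/-! ### Generic notions for finite groups: inner product, induction, characters -/

/-- The standard inner product `⟨f,h⟩_G = |G|⁻¹ ∑_{x ∈ G} f x * conj (h x)`. -/
def innerG (G : Type) [Group G] (f h : G → ℂ) : ℂ :=
  (Nat.card G : ℂ)⁻¹ * ∑ᶠ x : G, f x * (starRingEnd ℂ) (h x)

/-- Induction of a function from a subgroup, via the Frobenius formula. -/
def indFun {G : Type} [Group G] (H : Subgroup G) (ψ : ↥H → ℂ) : G → ℂ :=
  fun g => (Nat.card ↥H : ℂ)⁻¹ *
    ∑ᶠ x : G, if h : x * g * x⁻¹ ∈ H then ψ ⟨x * g * x⁻¹, h⟩ else 0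

/-- A function `G → ℂ` is a character if it is the trace character of some
finite-dimensional complex representation. -/
def IsCharacter (G : Type) [Group G] (f : G → ℂ) : Prop :=
  ∃ V : FDRep ℂ G, f = FDRep.character V

/-- The set of irreducible characters of `G`: characters of norm one. -/
def Irr (G : Type) [Group G] : Set (G → ℂ) :=
  {f | IsCharacter G f ∧ innerG G f f = 1}

/-- The set of irreducible constituents of `χ`: irreducible characters with
`⟨χ, ψ⟩_G > 0` (using the complex partial order). -/
def IrrConstituents (G : Type) [Group G] (χ : G → ℂ) : Set (G → ℂ) :=
  {f | f ∈ Irr G ∧ 0 < innerG G χ f}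

/-! ### Algebra groups -/

variable {F : Type} [Field F] [Fintype F] {R : Type} [Ring R] [Algebra F R] [Fintype R]

/-- `J` is a nilpotent (non-unital) subalgebra: all products of some fixed length vanish. -/
def IsNil (J : NonUnitalSubalgebra F R) : Prop :=
  ∃ N : ℕ, ∀ l : List R, (∀ x ∈ l, x ∈ J) → l.length = N → l.prod = 0

/-- The algebra group `G = 1 + J` of a (nilpotent) subalgebra `J ⊆ R`, realized as the
subgroup of units `u` of `R` with `u - 1 ∈ J` (and `u⁻¹ - 1 ∈ J`, which is automatic
when `J` is nilpotent). -/
def algGroup (F : Type) [Field F] [Fintype F] (R : Type) [Ring R] [Algebra F R] [Fintype R]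
    (J : NonUnitalSubalgebra F R) : Subgroup Rˣ where
  carrier := {u : Rˣ | ((u : R) - 1 ∈ J) ∧ (((u⁻¹ : Rˣ) : R) - 1 ∈ J)}
  one_mem' := by
    constructor <;> · simp only [Units.val_one, inv_one, sub_self]; exact J.zero_mem
  mul_mem' := by
    rintro u v ⟨hu1, hu2⟩ ⟨hv1, hv2⟩
    constructor
    · have h : ((u * v : Rˣ) : R) - 1 =
          ((u : R) - 1) * ((v : R) - 1) + ((u : R) - 1) + ((v : R) - 1) := by
        push_cast; noncomm_ring
      rw [h]
      exact add_mem (add_mem (mul_mem hu1 hv1) hu1) hv1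
    · have h : (((u * v)⁻¹ : Rˣ) : R) - 1 =
          (((v⁻¹ : Rˣ) : R) - 1) * (((u⁻¹ : Rˣ) : R) - 1) +
            (((v⁻¹ : Rˣ) : R) - 1) + (((u⁻¹ : Rˣ) : R) - 1) := by
        rw [mul_inv_rev]; push_cast; noncomm_ring
      rw [h]
      exact add_mem (add_mem (mul_mem hv2 hu2) hv2) hu2
  inv_mem' := by
    rintro u ⟨h1, h2⟩
    exact ⟨h2, by simpa using h1⟩

theorem mem_algGroup {J : NonUnitalSubalgebra F R} {u : Rˣ} :
    u ∈ algGroup F R J ↔ ((u : R) - 1 ∈ J) ∧ (((u⁻¹ : Rˣ) : R) - 1 ∈ J) :=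
  Iff.rfl

/-- The element `X ∈ J` such that `g = 1 + X`. -/
def gElt {J : NonUnitalSubalgebra F R} (g : ↥(algGroup F R J)) : ↥J :=
  ⟨((g : Rˣ) : R) - 1, g.2.1⟩

/-- The function `θ_λ(1+X) = θ(λ(X))` on the algebra group `1 + J`. -/
def thetaFn (θ : AddChar F ℂ) (J : NonUnitalSubalgebra F R) (lam : ↥J →ₗ[F] F) :
    ↥(algGroup F R J) → ℂ :=
  fun g => θ (lam (gElt g))

/-- Left multiplication by the group element `g` as a linear endomorphism of `J`. -/
def lmulMap {J : NonUnitalSubalgebra F R} (g : ↥(algGroup F R J)) : ↥J →ₗ[F] ↥J where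
  toFun X := ⟨((g : Rˣ) : R) * (X : R), by
    have h : ((g : Rˣ) : R) * (X : R) = (((g : Rˣ) : R) - 1) * (X : R) + (X : R) := by
      noncomm_ring
    rw [h]; exact add_mem (mul_mem g.2.1 X.2) X.2⟩
  map_add' X Y := by ext; simp [mul_add]
  map_smul' c X := by ext; simp [mul_smul_comm]

/-- Right multiplication by the group element `g` as a linear endomorphism of `J`. -/
def rmulMap {J : NonUnitalSubalgebra F R} (g : ↥(algGroup F R J)) : ↥J →ₗ[F] ↥J where
  toFun X := ⟨(X : R) * ((g : Rˣ) : R), by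
    have h : (X : R) * ((g : Rˣ) : R) = (X : R) * (((g : Rˣ) : R) - 1) + (X : R) := by
      noncomm_ring
    rw [h]; exact add_mem (mul_mem X.2 g.2.1) X.2⟩
  map_add' X Y := by ext; simp [add_mul]
  map_smul' c X := by ext; simp [smul_mul_assoc]

/-- The left action of `G` on the dual space: `(gλ)(X) = λ(g⁻¹ X)`. -/
def leftAct {J : NonUnitalSubalgebra F R} (g : ↥(algGroup F R J)) (lam : ↥J →ₗ[F] F) :
    ↥J →ₗ[F] F :=
  lam.comp (lmulMap g⁻¹)

/-- The right action of `G` on the dual space: `(λg)(X) = λ(X g⁻¹)`. -/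
def rightAct {J : NonUnitalSubalgebra F R} (g : ↥(algGroup F R J)) (lam : ↥J →ₗ[F] F) :
    ↥J →ₗ[F] F :=
  lam.comp (rmulMap g⁻¹)

/-- The coadjoint action of `G` on the dual space: `λ^g(X) = λ(g X g⁻¹)`. -/
def coAct {J : NonUnitalSubalgebra F R} (g : ↥(algGroup F R J)) (lam : ↥J →ₗ[F] F) :
    ↥J →ₗ[F] F :=
  lam.comp ((lmulMap g).comp (rmulMap g⁻¹))

/-- The left orbit `Gλ`. -/
def leftOrbit (J : NonUnitalSubalgebra F R) (lam : ↥J →ₗ[F] F) : Set (↥J →ₗ[F] F) :=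
  Set.range fun g : ↥(algGroup F R J) => leftAct g lam

/-- The right orbit `λG`. -/
def rightOrbit (J : NonUnitalSubalgebra F R) (lam : ↥J →ₗ[F] F) : Set (↥J →ₗ[F] F) :=
  Set.range fun g : ↥(algGroup F R J) => rightAct g lam

/-- The two-sided orbit `GλG`. -/
def twoOrbit (J : NonUnitalSubalgebra F R) (lam : ↥J →ₗ[F] F) : Set (↥J →ₗ[F] F) :=
  {mu | ∃ g h : ↥(algGroup F R J), mu = leftAct g (rightAct h lam)}

/-- The coadjoint orbit `λ^G`. -/
def coOrbit (J : NonUnitalSubalgebra F R) (lam : ↥J →ₗ[F] F) : Set (↥J →ₗ[F] F) :=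
  Set.range fun g : ↥(algGroup F R J) => coAct g lam

/-- The right orbit of `λ` under a subgroup `H` of the algebra group. -/
def rightOrbitUnder (J : NonUnitalSubalgebra F R) (H : Subgroup ↥(algGroup F R J))
    (lam : ↥J →ₗ[F] F) : Set (↥J →ₗ[F] F) :=
  {mu | ∃ s ∈ H, mu = rightAct s lam}

/-- The Kirillov function `ψ_λ = |λ^G|^{-1/2} ∑_{μ ∈ λ^G} θ_μ`. -/
def kirillov (θ : AddChar F ℂ) (J : NonUnitalSubalgebra F R) (lam : ↥J →ₗ[F] F) :
    ↥(algGroup F R J) → ℂ :=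
  fun g => ((Real.sqrt (Nat.card ↥(coOrbit J lam)) : ℂ))⁻¹ *
    ∑ᶠ mu ∈ coOrbit J lam, thetaFn θ J mu g

/-- The supercharacter `χ_λ = (|Gλ|/|GλG|) ∑_{μ ∈ GλG} θ_μ`. -/
def superchar (θ : AddChar F ℂ) (J : NonUnitalSubalgebra F R) (lam : ↥J →ₗ[F] F) :
    ↥(algGroup F R J) → ℂ :=
  fun g => ((Nat.card ↥(leftOrbit J lam) : ℂ) / (Nat.card ↥(twoOrbit J lam) : ℂ)) *
    ∑ᶠ mu ∈ twoOrbit J lam, thetaFn θ J mu g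

/-! ### The subalgebras `𝔩_λ`, `𝔰_λ` and their iterates -/

/-- The extension of `λ : J → F` by zero to all of `R`. -/
def lamE (J : NonUnitalSubalgebra F R) (lam : ↥J →ₗ[F] F) (x : R) : F :=
  if h : x ∈ J then lam ⟨x, h⟩ else 0

theorem lamE_apply (J : NonUnitalSubalgebra F R) (lam : ↥J →ₗ[F] F) {x : R} (hx : x ∈ J) :
    lamE J lam x = lam ⟨x, hx⟩ := dif_pos hx

theorem lamE_zero (J : NonUnitalSubalgebra F R) (lam : ↥J →ₗ[F] F) : lamE J lam 0 = 0 := by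
  rw [lamE_apply J lam J.zero_mem]
  have h : (⟨(0 : R), J.zero_mem⟩ : ↥J) = 0 := Subtype.ext rfl
  rw [h, map_zero]

theorem lamE_add (J : NonUnitalSubalgebra F R) (lam : ↥J →ₗ[F] F) {x y : R}
    (hx : x ∈ J) (hy : y ∈ J) : lamE J lam (x + y) = lamE J lam x + lamE J lam y := by
  rw [lamE, lamE, lamE, dif_pos (add_mem hx hy), dif_pos hx, dif_pos hy]
  have h : (⟨x + y, add_mem hx hy⟩ : ↥J) = ⟨x, hx⟩ + ⟨y, hy⟩ := Subtype.ext rfl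
  rw [h, map_add]

theorem lamE_smul (J : NonUnitalSubalgebra F R) (lam : ↥J →ₗ[F] F) (c : F) {x : R}
    (hx : x ∈ J) : lamE J lam (c • x) = c * lamE J lam x := by
  rw [lamE, lamE, dif_pos (SMulMemClass.smul_mem c hx), dif_pos hx]
  have h : (⟨c • x, SMulMemClass.smul_mem c hx⟩ : ↥J) = c • ⟨x, hx⟩ := Subtype.ext rfl
  rw [h, map_smul]
  rfl

/-- The left kernel `𝔩` of the bilinear form `(X,Y) ↦ λ(XY)` restricted to `s × s`. -/
def lStep (J : NonUnitalSubalgebra F R) (lam : ↥J →ₗ[F] F)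
    (s : NonUnitalSubalgebra F R) (hs : s ≤ J) : NonUnitalSubalgebra F R where
  carrier := {x | x ∈ s ∧ ∀ y ∈ s, lamE J lam (x * y) = 0}
  zero_mem' := ⟨zero_mem s, fun y _ => by rw [zero_mul, lamE_zero]⟩
  add_mem' := by
    rintro a b ⟨ha1, ha2⟩ ⟨hb1, hb2⟩
    refine ⟨add_mem ha1 hb1, fun y hy => ?_⟩
    rw [add_mul, lamE_add J lam (J.mul_mem (hs ha1) (hs hy)) (J.mul_mem (hs hb1) (hs hy)),
      ha2 y hy, hb2 y hy, add_zero]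
  smul_mem' := by
    rintro c a ⟨ha1, ha2⟩
    refine ⟨SMulMemClass.smul_mem c ha1, fun y hy => ?_⟩
    rw [smul_mul_assoc, lamE_smul J lam c (J.mul_mem (hs ha1) (hs hy)), ha2 y hy, mul_zero]
  mul_mem' := by
    rintro a b ⟨ha1, ha2⟩ ⟨hb1, hb2⟩
    refine ⟨mul_mem ha1 hb1, fun y hy => ?_⟩
    rw [mul_assoc]
    exact ha2 (b * y) (mul_mem hb1 hy)

theorem lStep_le (J : NonUnitalSubalgebra F R) (lam : ↥J →ₗ[F] F)
    (s : NonUnitalSubalgebra F R) (hs : s ≤ J) : lStep J lam s hs ≤ s :=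
  fun _ hx => hx.1

/-- The left kernel `𝔰` of the bilinear form `(X,Y) ↦ λ(XY)` restricted to `s × 𝔩`. -/
def sStep (J : NonUnitalSubalgebra F R) (lam : ↥J →ₗ[F] F)
    (s : NonUnitalSubalgebra F R) (hs : s ≤ J) : NonUnitalSubalgebra F R where
  carrier := {x | x ∈ s ∧ ∀ y ∈ lStep J lam s hs, lamE J lam (x * y) = 0}
  zero_mem' := ⟨zero_mem s, fun y _ => by rw [zero_mul, lamE_zero]⟩
  add_mem' := by
    rintro a b ⟨ha1, ha2⟩ ⟨hb1, hb2⟩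
    refine ⟨add_mem ha1 hb1, fun y hy => ?_⟩
    rw [add_mul, lamE_add J lam (J.mul_mem (hs ha1) (hs hy.1)) (J.mul_mem (hs hb1) (hs hy.1)),
      ha2 y hy, hb2 y hy, add_zero]
  smul_mem' := by
    rintro c a ⟨ha1, ha2⟩
    refine ⟨SMulMemClass.smul_mem c ha1, fun y hy => ?_⟩
    rw [smul_mul_assoc, lamE_smul J lam c (J.mul_mem (hs ha1) (hs hy.1)), ha2 y hy, mul_zero]
  mul_mem' := by
    rintro a b ⟨ha1, ha2⟩ ⟨hb1, hb2⟩
    refine ⟨mul_mem ha1 hb1, fun y hy => ?_⟩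
    rw [mul_assoc]
    refine ha2 (b * y) ⟨mul_mem hb1 hy.1, fun z hz => ?_⟩
    rw [mul_assoc]
    refine hb2 (y * z) ⟨mul_mem hy.1 hz, fun w hw => ?_⟩
    rw [mul_assoc]
    exact hy.2 (z * w) (mul_mem hz hw)

theorem sStep_le (J : NonUnitalSubalgebra F R) (lam : ↥J →ₗ[F] F)
    (s : NonUnitalSubalgebra F R) (hs : s ≤ J) : sStep J lam s hs ≤ s :=
  fun _ hx => hx.1

/-- `𝔩_λ`: the left kernel of `(X,Y) ↦ λ(XY)` on `J × J`. -/
def lone (J : NonUnitalSubalgebra F R) (lam : ↥J →ₗ[F] F) : NonUnitalSubalgebra F R :=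
  lStep J lam J le_rfl

/-- `𝔰_λ`: the left kernel of `(X,Y) ↦ λ(XY)` on `J × 𝔩_λ`. -/
def sone (J : NonUnitalSubalgebra F R) (lam : ↥J →ₗ[F] F) : NonUnitalSubalgebra F R :=
  sStep J lam J le_rfl

theorem lone_le (J : NonUnitalSubalgebra F R) (lam : ↥J →ₗ[F] F) : lone J lam ≤ J :=
  lStep_le J lam J le_rfl

theorem sone_le (J : NonUnitalSubalgebra F R) (lam : ↥J →ₗ[F] F) : sone J lam ≤ J :=
  sStep_le J lam J le_rfl

/-- `𝔨_λ = 𝔩_λ ∩ ker λ`. -/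
def kone (J : NonUnitalSubalgebra F R) (lam : ↥J →ₗ[F] F) : NonUnitalSubalgebra F R where
  carrier := {x | x ∈ lone J lam ∧ lamE J lam x = 0}
  zero_mem' := ⟨zero_mem _, lamE_zero J lam⟩
  add_mem' := by
    rintro a b ⟨ha1, ha2⟩ ⟨hb1, hb2⟩
    exact ⟨add_mem ha1 hb1, by
      rw [lamE_add J lam (lone_le J lam ha1) (lone_le J lam hb1), ha2, hb2, add_zero]⟩
  smul_mem' := by
    rintro c a ⟨ha1, ha2⟩
    exact ⟨SMulMemClass.smul_mem c ha1, by
      rw [lamE_smul J lam c (lone_le J lam ha1), ha2, mul_zero]⟩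
  mul_mem' := by
    rintro a b ⟨ha1, ha2⟩ ⟨hb1, hb2⟩
    exact ⟨mul_mem ha1 hb1, ha1.2 b (lone_le J lam hb1)⟩

theorem kone_le (J : NonUnitalSubalgebra F R) (lam : ↥J →ₗ[F] F) : kone J lam ≤ lone J lam :=
  fun _ hx => hx.1

/-- The descending chain `𝔰_λ^0 ⊇ 𝔰_λ^1 ⊇ ⋯` (bundled with the proof `𝔰_λ^i ≤ J`). -/
def sChainAux (J : NonUnitalSubalgebra F R) (lam : ↥J →ₗ[F] F) :
    ℕ → {s : NonUnitalSubalgebra F R // s ≤ J}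
  | 0 => ⟨J, le_rfl⟩
  | n + 1 =>
    ⟨sStep J lam (sChainAux J lam n).1 (sChainAux J lam n).2,
      le_trans (sStep_le J lam (sChainAux J lam n).1 (sChainAux J lam n).2)
        (sChainAux J lam n).2⟩

/-- `𝔰_λ^i`. -/
def sChain (J : NonUnitalSubalgebra F R) (lam : ↥J →ₗ[F] F) (i : ℕ) :
    NonUnitalSubalgebra F R :=
  (sChainAux J lam i).1

/-- `𝔩_λ^{i+1}`. -/
def lChain (J : NonUnitalSubalgebra F R) (lam : ↥J →ₗ[F] F) (i : ℕ) :
    NonUnitalSubalgebra F R :=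
  lStep J lam (sChainAux J lam i).1 (sChainAux J lam i).2

/-- The terminal element `𝔰̄_λ` of the descending chain; the chain has stabilized by
stage `|R|` since it is a weakly decreasing chain of subalgebras of the finite algebra. -/
def sbar (J : NonUnitalSubalgebra F R) (lam : ↥J →ₗ[F] F) : NonUnitalSubalgebra F R :=
  sChain J lam (Fintype.card R)

theorem sbar_le (J : NonUnitalSubalgebra F R) (lam : ↥J →ₗ[F] F) : sbar J lam ≤ J :=
  (sChainAux J lam (Fintype.card R)).2

/-- The terminal element `𝔩̄_λ` of the ascending chain. -/
def lbar (J : NonUnitalSubalgebra F R) (lam : ↥J →ₗ[F] F) : NonUnitalSubalgebra F R :=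
  lStep J lam (sbar J lam) (sbar_le J lam)

theorem lbar_le (J : NonUnitalSubalgebra F R) (lam : ↥J →ₗ[F] F) : lbar J lam ≤ J :=
  le_trans (lStep_le J lam _ _) (sbar_le J lam)

/-! ### Algebra subgroups of an algebra group -/

/-- The algebra subgroup `1 + k` of `1 + J`, as a subgroup of the ambient algebra group. -/
def algSubgroup (k J : NonUnitalSubalgebra F R) : Subgroup ↥(algGroup F R J) :=
  (algGroup F R k).subgroupOf (algGroup F R J)

/-- `L_λ = 1 + 𝔩_λ` as a subgroup of `G`. -/
def Lgrp (J : NonUnitalSubalgebra F R) (lam : ↥J →ₗ[F] F) : Subgroup ↥(algGroup F R J) :=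
  algSubgroup (lone J lam) J

/-- `S_λ = 1 + 𝔰_λ` as a subgroup of `G`. -/
def Sgrp (J : NonUnitalSubalgebra F R) (lam : ↥J →ₗ[F] F) : Subgroup ↥(algGroup F R J) :=
  algSubgroup (sone J lam) J

/-- `L̄_λ = 1 + 𝔩̄_λ` as a subgroup of `G`. -/
def Lbarg (J : NonUnitalSubalgebra F R) (lam : ↥J →ₗ[F] F) : Subgroup ↥(algGroup F R J) :=
  algSubgroup (lbar J lam) J

/-- `S̄_λ = 1 + 𝔰̄_λ` as a subgroup of `G`. -/
def Sbarg (J : NonUnitalSubalgebra F R) (lam : ↥J →ₗ[F] F) : Subgroup ↥(algGroup F R J) :=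
  algSubgroup (sbar J lam) J

/-- Passing from an element of the subgroup `1 + k ≤ 1 + J` to an element of the
algebra group `1 + k` in its own right. -/
def toAlg {k J : NonUnitalSubalgebra F R} (x : ↥(algSubgroup k J)) : ↥(algGroup F R k) :=
  ⟨((x : ↥(algGroup F R J)) : Rˣ), Subgroup.mem_subgroupOf.mp x.2⟩

/-- The linear inclusion of a smaller subalgebra. -/
def inclMap {s J : NonUnitalSubalgebra F R} (h : s ≤ J) : ↥s →ₗ[F] ↥J where
  toFun x := ⟨(x : R), h x.2⟩
  map_add' x y := rfl
  map_smul' c x := rfl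

/-- Restriction of a functional on `J` to a smaller subalgebra. -/
def resTo {s J : NonUnitalSubalgebra F R} (h : s ≤ J) (lam : ↥J →ₗ[F] F) : ↥s →ₗ[F] F :=
  lam.comp (inclMap h)

/-- The character `ξ_λ = Ind_{L̄_λ}^G (θ_λ)`. -/
def xi (θ : AddChar F ℂ) (J : NonUnitalSubalgebra F R) (lam : ↥J →ₗ[F] F) :
    ↥(algGroup F R J) → ℂ :=
  indFun (Lbarg J lam) (fun x => thetaFn θ J lam ↑x)

/-- The set `Ξ_λ = {g λ s g⁻¹ : g ∈ G, s ∈ S̄_λ}`. -/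
def Xi (J : NonUnitalSubalgebra F R) (lam : ↥J →ₗ[F] F) : Set (↥J →ₗ[F] F) :=
  {nu | ∃ g : ↥(algGroup F R J), ∃ s ∈ Sbarg J lam, nu = coAct g (rightAct s lam)}

/-! ### Normality of algebra subgroups coming from ideals -/

theorem conj_mem_aux (s a : NonUnitalSubalgebra F R)
    (hl : ∀ x ∈ s, ∀ y ∈ a, x * y ∈ a) (hr : ∀ y ∈ a, ∀ x ∈ s, y * x ∈ a)
    (u : Rˣ) (hu1 : (u : R) - 1 ∈ s) (hu2 : ((u⁻¹ : Rˣ) : R) - 1 ∈ s)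
    (x : Rˣ) (hx : (x : R) - 1 ∈ a) : ((u * x * u⁻¹ : Rˣ) : R) - 1 ∈ a := by
  have h1 : (u : R) * ((u⁻¹ : Rˣ) : R) = 1 := Units.mul_inv u
  have key : ((u * x * u⁻¹ : Rˣ) : R) - 1 =
      ((u : R) - 1) * ((x : R) - 1) * (((u⁻¹ : Rˣ) : R) - 1) +
        ((u : R) - 1) * ((x : R) - 1) + ((x : R) - 1) * (((u⁻¹ : Rˣ) : R) - 1) +
        ((x : R) - 1) := by
    push_cast
    calc (u : R) * (x : R) * ((u⁻¹ : Rˣ) : R) - 1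
        = (u : R) * (x : R) * ((u⁻¹ : Rˣ) : R) - (u : R) * ((u⁻¹ : Rˣ) : R) := by rw [h1]
      _ = _ := by noncomm_ring
  rw [key]
  exact add_mem (add_mem (add_mem (hr _ (hl _ hu1 _ hx) _ hu2) (hl _ hu1 _ hx))
    (hr _ hx _ hu2)) hx

theorem algSubgroup_normal (s a : NonUnitalSubalgebra F R)
    (hl : ∀ x ∈ s, ∀ y ∈ a, x * y ∈ a) (hr : ∀ y ∈ a, ∀ x ∈ s, y * x ∈ a) :
    ((algGroup F R a).subgroupOf (algGroup F R s)).Normal := by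
  constructor
  intro n hn g
  rw [Subgroup.mem_subgroupOf] at hn ⊢
  have hginv : ((g⁻¹ : ↥(algGroup F R s)) : Rˣ) = ((g : Rˣ))⁻¹ := rfl
  have hcoe : ((g * n * g⁻¹ : ↥(algGroup F R s)) : Rˣ) = (g : Rˣ) * (n : Rˣ) * ((g : Rˣ))⁻¹ := by
    push_cast [hginv]; rfl
  rw [mem_algGroup]
  constructor
  · rw [hcoe]
    exact conj_mem_aux s a hl hr (g : Rˣ) (g : ↥(algGroup F R s)).2.1 (g : ↥(algGroup F R s)).2.2
      (n : Rˣ) hn.1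
  · have hinv : (((g * n * g⁻¹ : ↥(algGroup F R s)) : Rˣ))⁻¹ =
        (g : Rˣ) * ((n : Rˣ))⁻¹ * ((g : Rˣ))⁻¹ := by
      rw [hcoe]; group
    rw [hinv]
    exact conj_mem_aux s a hl hr (g : Rˣ) (g : ↥(algGroup F R s)).2.1 (g : ↥(algGroup F R s)).2.2
      ((n : Rˣ))⁻¹ hn.2

theorem lone_mul_mem (J : NonUnitalSubalgebra F R) (lam : ↥J →ₗ[F] F)
    {y z : R} (hy : y ∈ lone J lam) (hz : z ∈ J) : y * z ∈ lone J lam := by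
  refine ⟨J.mul_mem (lone_le J lam hy) hz, fun w hw => ?_⟩
  rw [mul_assoc]
  exact hy.2 (z * w) (J.mul_mem hz hw)

theorem sone_mul_lone_mem (J : NonUnitalSubalgebra F R) (lam : ↥J →ₗ[F] F)
    {x y : R} (hx : x ∈ sone J lam) (hy : y ∈ lone J lam) : x * y ∈ lone J lam := by
  refine ⟨J.mul_mem (sone_le J lam hx) (lone_le J lam hy), fun w hw => ?_⟩
  rw [mul_assoc]
  exact hx.2 (y * w) (lone_mul_mem J lam hy hw)

theorem kone_ideal_left (J : NonUnitalSubalgebra F R) (lam : ↥J →ₗ[F] F) :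
    ∀ x ∈ sone J lam, ∀ y ∈ kone J lam, x * y ∈ kone J lam := by
  intro x hx y hy
  exact ⟨sone_mul_lone_mem J lam hx hy.1, hx.2 y hy.1⟩

theorem kone_ideal_right (J : NonUnitalSubalgebra F R) (lam : ↥J →ₗ[F] F) :
    ∀ y ∈ kone J lam, ∀ x ∈ sone J lam, y * x ∈ kone J lam := by
  intro y hy x hx
  exact ⟨lone_mul_mem J lam hy.1 (sone_le J lam hx), hy.1.2 x (sone_le J lam hx)⟩

/-- `K_λ = 1 + 𝔨_λ` as a (normal) subgroup of `S_λ = 1 + 𝔰_λ`. -/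
def KgrpIn (J : NonUnitalSubalgebra F R) (lam : ↥J →ₗ[F] F) :
    Subgroup ↥(algGroup F R (sone J lam)) :=
  (algGroup F R (kone J lam)).subgroupOf (algGroup F R (sone J lam))

instance KgrpIn_normal (J : NonUnitalSubalgebra F R) (lam : ↥J →ₗ[F] F) :
    (KgrpIn J lam).Normal :=
  algSubgroup_normal (sone J lam) (kone J lam) (kone_ideal_left J lam) (kone_ideal_right J lam)

/-- `L_λ = 1 + 𝔩_λ` as a (normal) subgroup of `S_λ = 1 + 𝔰_λ`. -/
def LgrpIn (J : NonUnitalSubalgebra F R) (lam : ↥J →ₗ[F] F) :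
    Subgroup ↥(algGroup F R (sone J lam)) :=
  (algGroup F R (lone J lam)).subgroupOf (algGroup F R (sone J lam))

instance LgrpIn_normal (J : NonUnitalSubalgebra F R) (lam : ↥J →ₗ[F] F) :
    (LgrpIn J lam).Normal :=
  algSubgroup_normal (sone J lam) (lone J lam)
    (fun x hx y hy => sone_mul_lone_mem J lam hx hy)
    (fun y hy x hx => lone_mul_mem J lam hy (sone_le J lam hx))

/-! ### Sums over finite groups and alternating forms -/

section Generic

/-- If the fibres of `φ : G → X` are right cosets of a subgroup, summing `f ∘ φ` over the group
is summing `f` over the range of `φ`, up to the common size of the fibres. -/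
theorem sum_comp_eq_card_mul_sum_range {G X : Type*} [Group G] [Fintype G] (φ : G → X)
    (hφ : ∀ g h, φ g = φ h ↔ φ (g * h⁻¹) = φ 1) (f : X → ℂ) :
    ∑ g, f (φ g) = (Nat.card {g // φ g = φ 1} : ℂ) * ∑ᶠ y ∈ Set.range φ, f y := by
  have hfib : ∀ y ∈ Finset.univ.image φ,
      ∑ g with φ g = y, f (φ g) = (Nat.card {g // φ g = φ 1} : ℂ) * f y := by
    intro y hy
    obtain ⟨h, -, rfl⟩ := Finset.mem_image.1 hy
    rw [Finset.sum_congr rfl (g := fun _ => f (φ h))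
      (fun g hg => by rw [(Finset.mem_filter.1 hg).2]), Finset.sum_const, nsmul_eq_mul]
    congr 2
    rw [Nat.card_eq_fintype_card, Fintype.card_subtype]
    refine Finset.card_bij (fun g _ => g * h⁻¹) ?_ ?_ ?_
    · intro g hg
      simpa using (hφ g h).1 (Finset.mem_filter.1 hg).2
    · intro a _ b _ hab
      simpa using hab
    · intro b hb
      refine ⟨b * h, ?_, by simp⟩
      simpa [hφ (b * h) h] using hb
  have hrange : Set.range φ = ((Finset.univ.image φ : Finset X) : Set X) := by simp
  rw [hrange, finsum_mem_coe_finset, Finset.mul_sum, ← Finset.sum_congr rfl hfib]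
  exact (Finset.sum_fiberwise_of_maps_to
    (fun i _ => Finset.mem_image_of_mem φ (Finset.mem_univ i)) _).symm

theorem card_eq_card_fibre_mul_card_range {G X : Type*} [Group G] [Fintype G] (φ : G → X)
    (hφ : ∀ g h, φ g = φ h ↔ φ (g * h⁻¹) = φ 1) :
    Nat.card G = Nat.card {g // φ g = φ 1} * Nat.card (Set.range φ) := by
  have h := sum_comp_eq_card_mul_sum_range φ hφ (fun _ => 1)
  rw [finsum_mem_eq_finite_toFinset_sum _ (Set.finite_range φ)] at h
  simp only [Finset.sum_const, nsmul_eq_mul, mul_one, Finset.card_univ] at h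
  rw [← Set.ncard_eq_toFinset_card _ (Set.finite_range φ)] at h
  rw [Nat.card_eq_fintype_card, Nat.card_coe_set_eq]
  exact_mod_cast h

open Pointwise in
/-- A set that is stable under right multiplication by a subgroup has cardinality divisible by
the order of that subgroup. -/
theorem card_subgroup_dvd_card_of_mul_mem {G : Type*} [Group G] (H : Subgroup G) (A : Set G)
    (hA : ∀ a ∈ A, ∀ h ∈ H, a * h ∈ A) : Nat.card H ∣ Nat.card A := by
  have h : A * (H : Set G) = A := by
    ext x
    constructor
    · rintro ⟨a, ha, h, hh, rfl⟩
      exact hA a ha h hh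
    · exact fun hx => ⟨x, hx, 1, H.one_mem, mul_one x⟩
  rw [← h, Subgroup.card_mul_eq_card_subgroup_mul_card_quotient]
  exact dvd_mul_right _ _

variable {K V : Type*} [Field K] [AddCommGroup V] [Module K V] [FiniteDimensional K V]

open Module LinearMap.BilinForm in
/-- The rank of an alternating form is even. -/
theorem exists_finrank_eq_finrank_ker_add (B : LinearMap.BilinForm K V) (hB : B.IsAlt) :
    ∃ d, finrank K V = finrank K (LinearMap.ker B) + (d + d) := by
  let P : ℕ → Prop := fun n => ∃ W : Submodule K V, W ≤ B.orthogonal W ∧ finrank K W = n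
  have hP0 : P 0 := ⟨⊥, bot_le, finrank_bot K V⟩
  have hbd : ∀ n, P n → n ≤ finrank K V := by
    rintro n ⟨W, -, rfl⟩
    exact Submodule.finrank_le W
  obtain ⟨W, hW, hWn⟩ : P (Nat.findGreatest P (finrank K V)) :=
    Nat.findGreatest_spec (Nat.zero_le _) hP0
  have hmax : B.orthogonal W ≤ W := by
    intro x hx
    by_contra hxW
    have hiso : W ⊔ K ∙ x ≤ B.orthogonal (W ⊔ K ∙ x) := by
      intro y hy
      obtain ⟨w, hw, z, hz, rfl⟩ := Submodule.mem_sup.1 hy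
      obtain ⟨c, rfl⟩ := Submodule.mem_span_singleton.1 hz
      intro y' hy'
      obtain ⟨w', hw', z', hz', rfl⟩ := Submodule.mem_sup.1 hy'
      obtain ⟨c', rfl⟩ := Submodule.mem_span_singleton.1 hz'
      have h1 : B w' w = 0 := hW hw w' hw'
      have h2 : B w' x = 0 := hx w' hw'
      have h3 : B x w = 0 := hB.isRefl w x (hx w hw)
      have h4 : B x x = 0 := hB x
      simp [h1, h2, h3, h4]
    have hle : finrank K ↥(W ⊔ K ∙ x) ≤ finrank K W := by
      rw [hWn]
      exact Nat.le_findGreatest (hbd _ ⟨_, hiso, rfl⟩) ⟨_, hiso, rfl⟩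
    have heq := Submodule.eq_of_le_of_finrank_le (le_sup_left : W ≤ W ⊔ K ∙ x) hle
    exact hxW (heq ▸ Submodule.mem_sup_right (Submodule.mem_span_singleton_self x))
  have h := finrank_add_finrank_orthogonal' (B := B) W
  have hker : LinearMap.ker B ≤ W := by
    intro x hx
    refine hmax fun y _ => hB.isRefl x y ?_
    rw [LinearMap.mem_ker.1 hx, LinearMap.zero_apply]
  rw [le_antisymm hmax hW, inf_eq_right.2 hker] at h
  have hle := Submodule.finrank_mono hker
  exact ⟨finrank K W - finrank K (LinearMap.ker B), by omega⟩

/-- If a bilinear form pairs `V'` with `V` and `W ≤ V` is the orthogonal of `V'`, every functional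
vanishing on `W` is given by an element of `V'`. -/
theorem range_eq_dualAnnihilator_of_forall_mem {V' : Type*} [AddCommGroup V'] [Module K V']
    (B : V' →ₗ[K] Module.Dual K V) (W : Submodule K V)
    (hW : ∀ x, x ∈ W ↔ ∀ y, B y x = 0) : LinearMap.range B = W.dualAnnihilator := by
  have h : (LinearMap.range B).dualCoannihilator = W := by
    ext x
    simp [hW, LinearMap.ext_iff]
  rw [← h, Subspace.dualCoannihilator_dualAnnihilator_eq]

end Generic

/-! ### Algebra groups of nilpotent algebras -/

theorem IsNil.mono {k J : NonUnitalSubalgebra F R} (hJ : IsNil J) (h : k ≤ J) : IsNil k := by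
  obtain ⟨N, hN⟩ := hJ
  exact ⟨N, fun l hl => hN l fun x hx => h (hl x hx)⟩

theorem algGroup_mono {k J : NonUnitalSubalgebra F R} (h : k ≤ J) :
    algGroup F R k ≤ algGroup F R J :=
  fun _ hu => ⟨h hu.1, h hu.2⟩

/-- The inclusion `1 + k → 1 + J`. -/
def algIncl {k J : NonUnitalSubalgebra F R} (h : k ≤ J) :
    ↥(algGroup F R k) →* ↥(algGroup F R J) :=
  Subgroup.inclusion (algGroup_mono h)

theorem gElt_injective {J : NonUnitalSubalgebra F R} :
    Function.Injective (gElt : ↥(algGroup F R J) → ↥J) := by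
  intro g h hgh
  have h1 : ((g : Rˣ) : R) - 1 = ((h : Rˣ) : R) - 1 := congrArg Subtype.val hgh
  exact Subtype.ext (Units.ext (sub_left_injective h1))

theorem gElt_surjective {J : NonUnitalSubalgebra F R} (hJ : IsNil J) :
    Function.Surjective (gElt : ↥(algGroup F R J) → ↥J) := by
  intro X
  obtain ⟨N, hN⟩ := hJ
  have hnil : IsNilpotent (X : R) := by
    refine ⟨N, ?_⟩
    have := hN (List.replicate N (X : R))
      (fun x hx => (List.eq_of_mem_replicate hx) ▸ X.2) List.length_replicate
    rwa [List.prod_replicate] at this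
  obtain ⟨u, hu⟩ := hnil.isUnit_one_add
  have hpow : ∀ n : ℕ, ((u ^ n : Rˣ) : R) - 1 ∈ J := by
    intro n
    induction n with
    | zero => simp
    | succ n ih =>
      have h : ((u ^ (n + 1) : Rˣ) : R) - 1 =
          (((u ^ n : Rˣ) : R) - 1) * X + (((u ^ n : Rˣ) : R) - 1) + X := by
        rw [pow_succ, Units.val_mul, hu]; noncomm_ring
      rw [h]
      exact add_mem (add_mem (mul_mem ih X.2) ih) X.2
  have hinv : u⁻¹ = u ^ (orderOf u - 1) := by
    rw [inv_eq_iff_mul_eq_one, ← pow_succ', Nat.sub_add_cancel (orderOf_pos u), pow_orderOf_eq_one]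
  refine ⟨⟨u, ?_, ?_⟩, Subtype.ext ?_⟩
  · simp [hu]
  · rw [hinv]; exact hpow _
  · simp [gElt, hu]

/-- The bijection `1 + X ↦ X` between an algebra group and its algebra. -/
def gEltEquiv {J : NonUnitalSubalgebra F R} (hJ : IsNil J) : ↥(algGroup F R J) ≃ ↥J :=
  Equiv.ofBijective gElt ⟨gElt_injective, gElt_surjective hJ⟩

theorem card_algGroup {J : NonUnitalSubalgebra F R} (hJ : IsNil J) :
    Nat.card ↥(algGroup F R J) = Nat.card ↥J :=
  Nat.card_congr (gEltEquiv hJ)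

theorem coe_mul_mem {J : NonUnitalSubalgebra F R} (g : ↥(algGroup F R J)) {x : R} (hx : x ∈ J) :
    ((g : Rˣ) : R) * x ∈ J :=
  (lmulMap g ⟨x, hx⟩).2

theorem mul_coe_mem {J : NonUnitalSubalgebra F R} (g : ↥(algGroup F R J)) {x : R} (hx : x ∈ J) :
    x * ((g : Rˣ) : R) ∈ J :=
  (rmulMap g ⟨x, hx⟩).2

/-! ### The coadjoint action -/

theorem coAct_apply {J : NonUnitalSubalgebra F R} (g : ↥(algGroup F R J)) (lam : ↥J →ₗ[F] F)
    (X : ↥J) : coAct g lam X =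
      lam ⟨((g : Rˣ) : R) * ((X : R) * (((g : Rˣ)⁻¹ : Rˣ) : R)),
        coe_mul_mem g (mul_coe_mem g⁻¹ X.2)⟩ := rfl

theorem coAct_one {J : NonUnitalSubalgebra F R} (lam : ↥J →ₗ[F] F) : coAct 1 lam = lam := by
  ext X
  rw [coAct_apply]
  congr 1
  ext
  simp

theorem coAct_mul {J : NonUnitalSubalgebra F R} (g h : ↥(algGroup F R J)) (lam : ↥J →ₗ[F] F) :
    coAct (g * h) lam = coAct h (coAct g lam) := by
  ext X
  simp only [coAct_apply]
  congr 1
  ext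
  simp [mul_assoc]

theorem coAct_eq_coAct_iff {J : NonUnitalSubalgebra F R} (lam : ↥J →ₗ[F] F)
    (g h : ↥(algGroup F R J)) :
    coAct g lam = coAct h lam ↔ coAct (g * h⁻¹) lam = coAct 1 lam := by
  rw [coAct_one, coAct_mul]
  constructor
  · intro e
    rw [e, ← coAct_mul, mul_inv_cancel, coAct_one]
  · intro e
    rw [← e, ← coAct_mul h⁻¹ h, inv_mul_cancel, coAct_one, e]

theorem thetaFn_conj (θ : AddChar F ℂ) {J : NonUnitalSubalgebra F R} (lam : ↥J →ₗ[F] F)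
    (x g : ↥(algGroup F R J)) :
    thetaFn θ J lam (x * g * x⁻¹) = θ (coAct x lam (gElt g)) := by
  rw [thetaFn, coAct_apply]
  congr 2
  ext
  simp [gElt, mul_sub, sub_mul, mul_assoc]

/-- The alternating form `(Y, X) ↦ λ(YX - XY)`. -/
def adForm {J : NonUnitalSubalgebra F R} (lam : ↥J →ₗ[F] F) : LinearMap.BilinForm F ↥J :=
  (LinearMap.mul F ↥J).compr₂ lam - ((LinearMap.mul F ↥J).compr₂ lam).flip

theorem adForm_apply {J : NonUnitalSubalgebra F R} (lam : ↥J →ₗ[F] F) (Y X : ↥J) :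
    adForm lam Y X = lam (Y * X) - lam (X * Y) := rfl

theorem adForm_isAlt {J : NonUnitalSubalgebra F R} (lam : ↥J →ₗ[F] F) : (adForm lam).IsAlt :=
  fun X => by rw [adForm_apply, sub_self]

theorem coAct_eq_self_iff {J : NonUnitalSubalgebra F R} (lam : ↥J →ₗ[F] F)
    (g : ↥(algGroup F R J)) : coAct g lam = lam ↔ adForm lam (gElt g) = 0 := by
  have key : ∀ X : ↥J, adForm lam (gElt g) X =
      coAct g lam (rmulMap g X) - lam (rmulMap g X) := by
    intro X
    have h1 : gElt g * X = lmulMap g X - X := by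
      ext; simp [gElt, lmulMap, sub_mul]
    have h2 : X * gElt g = rmulMap g X - X := by
      ext; simp [gElt, rmulMap, mul_sub]
    have h3 : coAct g lam (rmulMap g X) = lam (lmulMap g X) := by
      rw [coAct_apply]
      congr 1
      ext
      simp [rmulMap, lmulMap, mul_assoc]
    rw [adForm_apply, h1, h2, h3, map_sub, map_sub]
    ring
  constructor
  · intro h
    ext X
    rw [key, h, sub_self, LinearMap.zero_apply]
  · intro h
    ext X
    have hX : rmulMap g (rmulMap g⁻¹ X) = X := by
      ext; simp [rmulMap, mul_assoc]
    have := key (rmulMap g⁻¹ X)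
    rw [h, hX, LinearMap.zero_apply] at this
    exact (sub_eq_zero.1 this.symm)

theorem card_coStab {J : NonUnitalSubalgebra F R} (hJ : IsNil J) (lam : ↥J →ₗ[F] F) :
    Nat.card {g : ↥(algGroup F R J) // coAct g lam = coAct 1 lam} =
      Nat.card (LinearMap.ker (adForm lam)) :=
  Nat.card_congr ((gEltEquiv hJ).subtypeEquiv fun g => by
    rw [coAct_one, coAct_eq_self_iff]; rfl)

theorem card_coOrbit_mul_card_ker {J : NonUnitalSubalgebra F R} (hJ : IsNil J)
    (lam : ↥J →ₗ[F] F) :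
    Nat.card (coOrbit J lam) * Nat.card (LinearMap.ker (adForm lam)) = Nat.card ↥J := by
  rw [← card_algGroup hJ, ← card_coStab hJ lam, mul_comm]
  exact (card_eq_card_fibre_mul_card_range (fun g => coAct g lam) (coAct_eq_coAct_iff lam)).symm

theorem card_coOrbit_pos (J : NonUnitalSubalgebra F R) (lam : ↥J →ₗ[F] F) :
    0 < Nat.card (coOrbit J lam) :=
  have : Nonempty (coOrbit J lam) := ⟨⟨_, 1, rfl⟩⟩
  have : Finite (coOrbit J lam) := Set.finite_range _
  Nat.card_pos

theorem exists_card_coOrbit_eq_mul_self {J : NonUnitalSubalgebra F R} (hJ : IsNil J)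
    (lam : ↥J →ₗ[F] F) : ∃ n, 0 < n ∧ Nat.card (coOrbit J lam) = n * n := by
  obtain ⟨d, hd⟩ := exists_finrank_eq_finrank_ker_add _ (adForm_isAlt lam)
  refine ⟨Nat.card F ^ d, pow_pos Nat.card_pos _, ?_⟩
  have h := card_coOrbit_mul_card_ker hJ lam
  rw [Module.natCard_eq_pow_finrank (K := F) (V := ↥J), hd, pow_add,
    Module.natCard_eq_pow_finrank (K := F) (V := LinearMap.ker (adForm lam)), mul_comm] at h
  rw [Nat.eq_of_mul_eq_mul_left (pow_pos Nat.card_pos _) h, pow_add]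

/-- The Kirillov function as an average over the group instead of over the coadjoint orbit. -/
theorem kirillov_eq_sum (θ : AddChar F ℂ) {J : NonUnitalSubalgebra F R} (hJ : IsNil J)
    (lam : ↥J →ₗ[F] F) (g : ↥(algGroup F R J)) :
    kirillov θ J lam g = (Real.sqrt (Nat.card (coOrbit J lam)) : ℂ) / (Nat.card ↥J : ℂ) *
      ∑ x : ↥(algGroup F R J), thetaFn θ J lam (x * g * x⁻¹) := by
  have h := sum_comp_eq_card_mul_sum_range (fun x : ↥(algGroup F R J) => coAct x lam)
    (coAct_eq_coAct_iff lam) (fun mu => thetaFn θ J mu g)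
  have hpos := card_coOrbit_pos J lam
  have hcard := card_coOrbit_mul_card_ker hJ lam
  simp only [thetaFn_conj]
  have hJ0 : (Nat.card ↥J : ℂ) ≠ 0 := by exact_mod_cast Nat.card_pos.ne'
  have hs : (Real.sqrt (Nat.card (coOrbit J lam)) : ℂ) ≠ 0 := by
    exact_mod_cast (Real.sqrt_pos.2 (by exact_mod_cast hpos)).ne'
  have hsq : (Real.sqrt (Nat.card (coOrbit J lam)) : ℂ) * Real.sqrt (Nat.card (coOrbit J lam)) =
      (Nat.card (coOrbit J lam) : ℂ) := by
    rw [← Complex.ofReal_mul, Real.mul_self_sqrt (Nat.cast_nonneg _), Complex.ofReal_natCast]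
  have hcard' : (Nat.card (coOrbit J lam) : ℂ) * (Nat.card (LinearMap.ker (adForm lam)) : ℂ) =
      (Nat.card ↥J : ℂ) := by exact_mod_cast hcard
  rw [kirillov]
  change _ = _ * ∑ x : ↥(algGroup F R J), thetaFn θ J (coAct x lam) g
  rw [h, card_coStab hJ, ← mul_assoc]
  congr 1
  rw [← hcard', ← hsq]
  rw [← hcard', ← hsq] at hJ0
  have hk := right_ne_zero_of_mul hJ0
  field_simp

/-! ### Pairs of subalgebras orthogonal to each other -/

theorem sum_addChar_linear (θ : AddChar F ℂ) (hθ : θ ≠ 1) {V : Type*} [AddCommGroup V]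
    [Module F V] [Fintype V] (φ : V →ₗ[F] F) :
    ∑ v, θ (φ v) = if φ = 0 then (Nat.card V : ℂ) else 0 := by
  have h := AddChar.sum_eq_ite (θ.compAddMonoidHom φ.toAddMonoidHom)
  have hiff : θ.compAddMonoidHom φ.toAddMonoidHom = 0 ↔ φ = 0 := by
    constructor
    · intro h0
      by_contra hφ
      obtain ⟨c, hc⟩ := AddChar.ne_one_iff.1 hθ
      obtain ⟨v, rfl⟩ := LinearMap.surjective hφ c
      exact hc (DFunLike.congr_fun h0 v)
    · rintro rfl
      ext v
      simp
  rw [Nat.card_eq_fintype_card]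
  simp only [hiff] at h
  rw [← h]
  rfl

/-- The subspace of `J` underlying a subalgebra `s ≤ J`. -/
def subOf {s J : NonUnitalSubalgebra F R} (h : s ≤ J) : Submodule F ↥J :=
  LinearMap.range (inclMap h)

theorem mem_subOf {s J : NonUnitalSubalgebra F R} (h : s ≤ J) {X : ↥J} :
    X ∈ subOf h ↔ (X : R) ∈ s := by
  constructor
  · rintro ⟨x, rfl⟩
    exact x.2
  · exact fun hx => ⟨⟨X, hx⟩, rfl⟩

theorem inclMap_injective {s J : NonUnitalSubalgebra F R} (h : s ≤ J) :
    Function.Injective (inclMap h) :=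
  fun _ _ e => Subtype.ext (congrArg (fun X : ↥J => (X : R)) e)

/-- The subalgebra `l` is an ideal of `s`, left and right orthogonal to `s` for `(X, Y) ↦ λ(XY)`,
and `s` contains the orthogonal of `l` for the alternating form `(Y, X) ↦ λ(YX - XY)`. -/
structure IsOrthPair (J : NonUnitalSubalgebra F R) (lam : ↥J →ₗ[F] F)
    (s l : NonUnitalSubalgebra F R) : Prop where
  s_le : s ≤ J
  l_le : l ≤ s
  left_mem : ∀ x ∈ s, ∀ y ∈ l, x * y ∈ l
  right_mem : ∀ y ∈ l, ∀ x ∈ s, y * x ∈ l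
  left_zero : ∀ x ∈ s, ∀ y ∈ l, lamE J lam (x * y) = 0
  right_zero : ∀ y ∈ l, ∀ x ∈ s, lamE J lam (y * x) = 0
  mem_of_comm : ∀ x ∈ J, (∀ y ∈ l, lamE J lam (y * x) = lamE J lam (x * y)) → x ∈ s

namespace IsOrthPair

variable {J s l : NonUnitalSubalgebra F R} {lam : ↥J →ₗ[F] F}

theorem lamE_conj (h : IsOrthPair J lam s l) {y t u : R} (hy : y ∈ l) (ht : t - 1 ∈ s)
    (hu : u - 1 ∈ s) : t * (y * u) ∈ l ∧ lamE J lam (t * (y * u)) = lamE J lam y := by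
  have h1 : y * (u - 1) ∈ l := h.right_mem y hy _ hu
  have h2 : y * u = y * (u - 1) + y := by noncomm_ring
  have h3 : y * u ∈ l := h2 ▸ add_mem h1 hy
  have h4 : (t - 1) * (y * u) ∈ l := h.left_mem _ ht _ h3
  have h5 : t * (y * u) = (t - 1) * (y * u) + (y * (u - 1) + y) := by noncomm_ring
  have hlJ : l ≤ J := h.l_le.trans h.s_le
  refine ⟨?_, ?_⟩
  · rw [h5]
    exact add_mem h4 (add_mem h1 hy)
  · rw [h5, lamE_add J lam (hlJ h4) (add_mem (hlJ h1) (hlJ hy)), lamE_add J lam (hlJ h1) (hlJ hy),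
      h.left_zero _ ht _ h3, h.right_zero _ hy _ hu, zero_add, zero_add]

/-- The pairing of `l` with `J` given by the alternating form of `λ`. -/
def pairing (h : IsOrthPair J lam s l) : ↥l →ₗ[F] Module.Dual F ↥J :=
  LinearMap.comp (adForm lam) (inclMap (h.l_le.trans h.s_le))

theorem pairing_apply (h : IsOrthPair J lam s l) (y : ↥l) (X : ↥J) :
    h.pairing y X = lamE J lam ((y : R) * X) - lamE J lam ((X : R) * y) := by
  have hy : (y : R) ∈ J := h.s_le (h.l_le y.2)
  rw [lamE_apply J lam (mul_mem hy X.2), lamE_apply J lam (mul_mem X.2 hy)]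
  rfl

theorem mem_subOf_iff (h : IsOrthPair J lam s l) (X : ↥J) :
    X ∈ subOf h.s_le ↔ ∀ y, h.pairing y X = 0 := by
  rw [mem_subOf]
  constructor
  · intro hX y
    rw [pairing_apply, h.right_zero y y.2 X hX, h.left_zero X hX y y.2, sub_zero]
  · intro hX
    refine h.mem_of_comm X X.2 fun y hy => sub_eq_zero.1 ?_
    rw [← h.pairing_apply ⟨y, hy⟩, hX]

theorem range_pairing (h : IsOrthPair J lam s l) :
    LinearMap.range h.pairing = (subOf h.s_le).dualAnnihilator :=
  range_eq_dualAnnihilator_of_forall_mem _ _ h.mem_subOf_iff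

theorem coAct_sub_mem (h : IsOrthPair J lam s l) (t : ↥(algGroup F R l)) :
    coAct (algIncl (h.l_le.trans h.s_le) t) lam - lam ∈ (subOf h.s_le).dualAnnihilator := by
  rw [Submodule.mem_dualAnnihilator]
  intro X hX
  rw [mem_subOf] at hX
  have hX2 : (X : R) * (((t : Rˣ)⁻¹ : Rˣ) : R) ∈ s :=
    mul_coe_mem ((algIncl h.l_le t)⁻¹) hX
  have h3 : ((t : Rˣ) : R) * ((X : R) * (((t : Rˣ)⁻¹ : Rˣ) : R)) =
      (((t : Rˣ) : R) - 1) * ((X : R) * (((t : Rˣ)⁻¹ : Rˣ) : R)) +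
        ((X : R) * ((((t : Rˣ)⁻¹ : Rˣ) : R) - 1) + X) := by noncomm_ring
  have hl : ((t : Rˣ) : R) - 1 ∈ l := t.2.1
  have hl' : (((t : Rˣ)⁻¹ : Rˣ) : R) - 1 ∈ l := t.2.2
  have e : coAct (algIncl (h.l_le.trans h.s_le) t) lam X = lamE J lam
      (((t : Rˣ) : R) * ((X : R) * (((t : Rˣ)⁻¹ : Rˣ) : R))) := (lamE_apply J lam _).symm
  rw [LinearMap.sub_apply, e, h3, lamE_add J lam, lamE_add J lam _ X.2, h.right_zero _ hl _ hX2,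
    h.left_zero _ hX _ hl', lamE_apply J lam X.2, zero_add, zero_add, sub_self]
  · exact h.s_le (mul_mem hX (h.l_le hl'))
  · exact h.s_le (mul_mem (h.l_le hl) hX2)
  · exact add_mem (h.s_le (mul_mem hX (h.l_le hl'))) X.2

theorem coAct_algIncl_fibre (h : IsOrthPair J lam s l) (g t : ↥(algGroup F R l)) :
    coAct (algIncl (h.l_le.trans h.s_le) g) lam = coAct (algIncl (h.l_le.trans h.s_le) t) lam ↔
      coAct (algIncl (h.l_le.trans h.s_le) (g * t⁻¹)) lam =
        coAct (algIncl (h.l_le.trans h.s_le) 1) lam := by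
  rw [coAct_eq_coAct_iff, map_mul, map_inv, map_one]

theorem card_fibre (h : IsOrthPair J lam s l) (hJ : IsNil J) :
    Nat.card {g : ↥(algGroup F R l) // coAct (algIncl (h.l_le.trans h.s_le) g) lam =
      coAct (algIncl (h.l_le.trans h.s_le) 1) lam} = Nat.card (LinearMap.ker h.pairing) :=
  Nat.card_congr ((gEltEquiv (hJ.mono (h.l_le.trans h.s_le))).subtypeEquiv fun g => by
    rw [map_one, coAct_one, coAct_eq_self_iff]; rfl)

theorem card_ker_pairing_mul (h : IsOrthPair J lam s l) :
    Nat.card (LinearMap.ker h.pairing) * Nat.card (subOf h.s_le).dualAnnihilator =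
      Nat.card ↥l := by
  rw [← h.range_pairing, Module.natCard_eq_pow_finrank (K := F) (V := LinearMap.ker h.pairing),
    Module.natCard_eq_pow_finrank (K := F) (V := LinearMap.range h.pairing), ← pow_add,
    Module.natCard_eq_pow_finrank (K := F) (V := ↥l), add_comm,
    LinearMap.finrank_range_add_finrank_ker]

theorem range_coAct_algIncl (h : IsOrthPair J lam s l) (hJ : IsNil J) :
    (Set.range fun t => coAct (algIncl (h.l_le.trans h.s_le) t) lam) =
      (fun nu => lam + nu) '' ((subOf h.s_le).dualAnnihilator : Set (Module.Dual F ↥J)) := by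
  have hfin : Finite (Module.Dual F ↥J) := Module.finite_of_finite F
  refine Set.eq_of_subset_of_ncard_le ?_ ?_ (Set.toFinite _)
  · rintro _ ⟨t, rfl⟩
    exact ⟨_, h.coAct_sub_mem t, by simp⟩
  · rw [Set.ncard_image_of_injective _ (add_right_injective lam)]
    have h1 := card_eq_card_fibre_mul_card_range _ h.coAct_algIncl_fibre
    rw [h.card_fibre hJ, card_algGroup (hJ.mono (h.l_le.trans h.s_le)),
      ← h.card_ker_pairing_mul] at h1
    exact (Nat.eq_of_mul_eq_mul_left Nat.card_pos h1).le

/-- Averaging `θ_λ` over `1 + l` gives `θ_λ` cut off to `1 + s`. -/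
theorem sum_theta_coAct (h : IsOrthPair J lam s l) (hJ : IsNil J) (θ : AddChar F ℂ) (hθ : θ ≠ 1)
    (Z : ↥J) : ∑ t : ↥(algGroup F R l), θ (coAct (algIncl (h.l_le.trans h.s_le) t) lam Z) =
      (Nat.card ↥l : ℂ) * if (Z : R) ∈ s then θ (lam Z) else 0 := by
  have hfin : Finite (Module.Dual F ↥J) := Module.finite_of_finite F
  have := Fintype.ofFinite (Module.Dual F ↥J)
  rw [sum_comp_eq_card_mul_sum_range _ h.coAct_algIncl_fibre (fun mu => θ (mu Z)),
    h.range_coAct_algIncl hJ, finsum_mem_image (add_right_injective lam).injOn, h.card_fibre hJ,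
    ← finsum_set_coe_eq_finsum_mem, finsum_eq_sum_of_fintype]
  let ev : ↥(subOf h.s_le).dualAnnihilator →ₗ[F] F :=
    (Module.Dual.eval F ↥J Z).comp (subOf h.s_le).dualAnnihilator.subtype
  have hev : ev = 0 ↔ (Z : R) ∈ s := by
    have h0 : Z ∈ (subOf h.s_le).dualAnnihilator.dualCoannihilator ↔ (Z : R) ∈ s := by
      rw [Subspace.dualAnnihilator_dualCoannihilator_eq, mem_subOf]
    rw [← h0, Submodule.mem_dualCoannihilator]
    exact ⟨fun h0 nu hnu => DFunLike.congr_fun h0 ⟨nu, hnu⟩,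
      fun h0 => LinearMap.ext fun nu => h0 nu nu.2⟩
  have h1 : ∀ nu : ↥((subOf h.s_le).dualAnnihilator : Set (Module.Dual F ↥J)),
      θ ((lam + (nu : Module.Dual F ↥J)) Z) = θ (lam Z) * θ (ev nu) := fun nu => by
    rw [← AddChar.map_add_eq_mul]
    rfl
  have h2 := sum_addChar_linear θ hθ (V := ↥(subOf h.s_le).dualAnnihilator) ev
  rw [Finset.sum_congr rfl fun nu _ => h1 nu, ← Finset.mul_sum, ← h.card_ker_pairing_mul]
  rw [if_congr hev rfl rfl] at h2
  refine (congrArg (fun z => _ * (θ (lam Z) * z)) h2).trans ?_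
  split_ifs
  · push_cast
    ring
  · simp

end IsOrthPair

/-! ### Induction of Kirillov functions -/

theorem sum_sum_conj {G K : Type*} [Group G] [Fintype G] [Group K] [Fintype K] (i : K →* G)
    (f : G → ℂ) (g : G) :
    ∑ x : G, ∑ t : K, f (i t * (x * g * x⁻¹) * (i t)⁻¹) =
      (Nat.card K : ℂ) * ∑ x : G, f (x * g * x⁻¹) := by
  rw [Finset.sum_comm]
  have h : ∀ t : K, ∑ x : G, f (i t * (x * g * x⁻¹) * (i t)⁻¹) = ∑ x : G, f (x * g * x⁻¹) := by
    intro t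
    rw [← Equiv.sum_comp (Equiv.mulLeft (i t)) fun x => f (x * g * x⁻¹)]
    refine Finset.sum_congr rfl fun x _ => congrArg f ?_
    simp [mul_assoc]
  rw [Finset.sum_congr rfl fun t _ => h t, Finset.sum_const, Finset.card_univ, nsmul_eq_mul,
    Nat.card_eq_fintype_card]

theorem mem_algSubgroup_iff {s J : NonUnitalSubalgebra F R} (hs : IsNil s)
    (g : ↥(algGroup F R J)) : g ∈ algSubgroup s J ↔ (gElt g : R) ∈ s := by
  rw [algSubgroup, Subgroup.mem_subgroupOf]
  constructor
  · exact fun h => h.1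
  · intro h
    obtain ⟨u, hu⟩ := gElt_surjective hs ⟨_, h⟩
    have hug : (u : Rˣ) = g :=
      Units.ext (sub_left_injective (congrArg (fun X : ↥s => (X : R)) hu))
    exact hug ▸ u.2

theorem card_algSubgroup {s J : NonUnitalSubalgebra F R} (h : s ≤ J) (hs : IsNil s) :
    Nat.card (algSubgroup s J) = Nat.card ↥s := by
  rw [← card_algGroup hs]
  exact Nat.card_congr (Subgroup.subgroupOfEquivOfLe (algGroup_mono h)).toEquiv

theorem indFun_kirillov_apply (θ : AddChar F ℂ) {s J : NonUnitalSubalgebra F R} (h : s ≤ J)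
    (hs : IsNil s) (lam : ↥J →ₗ[F] F) (g : ↥(algGroup F R J)) :
    indFun (algSubgroup s J) (fun x => kirillov θ s (resTo h lam) (toAlg x)) g =
      (Real.sqrt (Nat.card (coOrbit s (resTo h lam))) : ℂ) / (Nat.card ↥s : ℂ) *
        ∑ x : ↥(algGroup F R J),
          if (gElt (x * g * x⁻¹) : R) ∈ s then thetaFn θ J lam (x * g * x⁻¹) else 0 := by
  have hs0 : (Nat.card ↥s : ℂ) ≠ 0 := by exact_mod_cast Nat.card_pos.ne'
  have key : ∀ y : ↥(algGroup F R J),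
      (if hy : y ∈ algSubgroup s J then
        kirillov θ s (resTo h lam) (toAlg (⟨y, hy⟩ : ↥(algSubgroup s J))) else 0) =
      (Real.sqrt (Nat.card (coOrbit s (resTo h lam))) : ℂ) / (Nat.card ↥s : ℂ) *
        ∑ t : ↥(algGroup F R s), if (gElt (algIncl h t * y * (algIncl h t)⁻¹) : R) ∈ s then
          thetaFn θ J lam (algIncl h t * y * (algIncl h t)⁻¹) else 0 := by
    intro y
    have hconj : ∀ t : ↥(algGroup F R s),
        (gElt (algIncl h t * y * (algIncl h t)⁻¹) : R) ∈ s ↔ y ∈ algSubgroup s J := by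
      intro t
      rw [← mem_algSubgroup_iff hs]
      have ht : algIncl h t ∈ algSubgroup s J := t.2
      rw [Subgroup.mul_mem_cancel_right _ (inv_mem ht), Subgroup.mul_mem_cancel_left _ ht]
    split_ifs with hy
    · rw [kirillov_eq_sum θ hs]
      congr 1
      refine Finset.sum_congr rfl fun t _ => ?_
      rw [if_pos ((hconj t).2 hy)]
      rfl
    · rw [Finset.sum_eq_zero fun t _ => if_neg fun h' => hy ((hconj t).1 h'), mul_zero]
  rw [indFun, finsum_eq_sum_of_fintype, Finset.sum_congr rfl fun x _ => key (x * g * x⁻¹),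
    ← Finset.mul_sum, sum_sum_conj (algIncl h)
      (fun y => if (gElt y : R) ∈ s then thetaFn θ J lam y else 0) g,
    card_algSubgroup h hs, card_algGroup hs]
  field_simp

namespace IsOrthPair

variable {J s l : NonUnitalSubalgebra F R} {lam : ↥J →ₗ[F] F}

theorem map_ker_adForm_resTo (h : IsOrthPair J lam s l) :
    (LinearMap.ker (adForm (resTo h.s_le lam))).map (inclMap h.s_le) =
      (adForm lam).orthogonal (subOf h.s_le) := by
  ext X
  constructor
  · rintro ⟨x, hx, rfl⟩
    rintro _ ⟨y, rfl⟩
    have h1 : adForm (resTo h.s_le lam) x y = 0 := DFunLike.congr_fun hx y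
    exact (adForm_isAlt lam).isRefl _ _ h1
  · intro hX
    have hXs : (X : R) ∈ s := by
      rw [← mem_subOf h.s_le, h.mem_subOf_iff]
      exact fun y => hX _ ⟨⟨y, h.l_le y.2⟩, rfl⟩
    refine ⟨⟨X, hXs⟩, LinearMap.ext fun y => ?_, rfl⟩
    exact (adForm_isAlt lam).isRefl _ _ (hX _ ⟨y, rfl⟩)

theorem ker_adForm_le (h : IsOrthPair J lam s l) :
    LinearMap.ker (adForm lam) ≤ subOf h.s_le := by
  intro X hX
  rw [h.mem_subOf_iff]
  exact fun y => (adForm_isAlt lam).isRefl _ _ (DFunLike.congr_fun hX _)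

theorem card_mul_card_ker (h : IsOrthPair J lam s l) :
    Nat.card ↥s * Nat.card (LinearMap.ker (adForm (resTo h.s_le lam))) =
      Nat.card ↥J * Nat.card (LinearMap.ker (adForm lam)) := by
  have h1 := LinearMap.BilinForm.finrank_add_finrank_orthogonal' (B := adForm lam)
    (subOf h.s_le)
  rw [inf_eq_right.2 h.ker_adForm_le, ← h.map_ker_adForm_resTo,
    ← (Submodule.equivMapOfInjective _ (inclMap_injective h.s_le) _).finrank_eq, subOf,
    LinearMap.finrank_range_of_inj (inclMap_injective h.s_le)] at h1
  rw [Module.natCard_eq_pow_finrank (K := F) (V := ↥s),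
    Module.natCard_eq_pow_finrank (K := F) (V := ↥J),
    Module.natCard_eq_pow_finrank (K := F) (V := ↥(LinearMap.ker (adForm lam))),
    Module.natCard_eq_pow_finrank (K := F)
      (V := ↥(LinearMap.ker (adForm (resTo h.s_le lam)))), ← pow_add, ← pow_add, h1]

theorem sqrt_card_coOrbit_mul (h : IsOrthPair J lam s l) (hJ : IsNil J) :
    (Real.sqrt (Nat.card (coOrbit J lam)) : ℂ) * Nat.card ↥s =
      (Real.sqrt (Nat.card (coOrbit s (resTo h.s_le lam))) : ℂ) * Nat.card ↥J := by
  have h1 := card_coOrbit_mul_card_ker hJ lam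
  have h2 := card_coOrbit_mul_card_ker (hJ.mono h.s_le) (resTo h.s_le lam)
  have h3 := h.card_mul_card_ker
  have h4 : Nat.card (coOrbit J lam) * (Nat.card ↥s * Nat.card ↥s) =
      Nat.card (coOrbit s (resTo h.s_le lam)) * (Nat.card ↥J * Nat.card ↥J) := by
    calc _ = Nat.card (coOrbit J lam) * (Nat.card ↥s * (Nat.card (coOrbit s (resTo h.s_le lam)) *
          Nat.card (LinearMap.ker (adForm (resTo h.s_le lam))))) := by rw [h2]
      _ = Nat.card (coOrbit J lam) * Nat.card (coOrbit s (resTo h.s_le lam)) *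
          (Nat.card ↥s * Nat.card (LinearMap.ker (adForm (resTo h.s_le lam)))) := by ring
      _ = Nat.card (coOrbit s (resTo h.s_le lam)) * Nat.card ↥J *
          (Nat.card (coOrbit J lam) * Nat.card (LinearMap.ker (adForm lam))) := by
        rw [h3]; ring
      _ = _ := by rw [h1]; ring
  have h5 : Real.sqrt (Nat.card (coOrbit J lam)) * Nat.card ↥s =
      Real.sqrt (Nat.card (coOrbit s (resTo h.s_le lam))) * Nat.card ↥J := by
    rw [← Real.sqrt_mul_self (Nat.cast_nonneg (Nat.card ↥s)),
      ← Real.sqrt_mul_self (Nat.cast_nonneg (Nat.card ↥J)),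
      ← Real.sqrt_mul (Nat.cast_nonneg _), ← Real.sqrt_mul (Nat.cast_nonneg _)]
    exact congrArg Real.sqrt (by exact_mod_cast h4)
  exact_mod_cast congrArg (fun r : ℝ => (r : ℂ)) h5

/-- Inducing the Kirillov function of the restriction to `1 + s` gives the Kirillov function. -/
theorem indFun_kirillov (h : IsOrthPair J lam s l) (hJ : IsNil J) (θ : AddChar F ℂ)
    (hθ : θ ≠ 1) :
    indFun (algSubgroup s J) (fun x => kirillov θ s (resTo h.s_le lam) (toAlg x)) =
      kirillov θ J lam := by
  have hs := hJ.mono h.s_le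
  have hl := hs.mono h.l_le
  have hs0 : (Nat.card ↥s : ℂ) ≠ 0 := by exact_mod_cast Nat.card_pos.ne'
  have hl0 : (Nat.card ↥l : ℂ) ≠ 0 := by exact_mod_cast Nat.card_pos.ne'
  have hJ0 : (Nat.card ↥J : ℂ) ≠ 0 := by exact_mod_cast Nat.card_pos.ne'
  funext g
  rw [indFun_kirillov_apply θ h.s_le hs, kirillov_eq_sum θ hJ]
  have h1 := sum_sum_conj (algIncl (h.l_le.trans h.s_le)) (thetaFn θ J lam) g
  simp only [thetaFn_conj θ lam (algIncl _ _), h.sum_theta_coAct hJ θ hθ] at h1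
  rw [← Finset.mul_sum, card_algGroup hl] at h1
  rw [← mul_left_cancel₀ hl0 h1, ← (div_eq_div_iff hJ0 hs0).2 (h.sqrt_card_coOrbit_mul hJ)]
  rfl

end IsOrthPair

/-! ### Inner products with Kirillov functions -/

theorem kirillov_conj (θ : AddChar F ℂ) {J : NonUnitalSubalgebra F R} (hJ : IsNil J)
    (lam : ↥J →ₗ[F] F) (x g : ↥(algGroup F R J)) :
    kirillov θ J lam (x * g * x⁻¹) = kirillov θ J lam g := by
  rw [kirillov_eq_sum θ hJ, kirillov_eq_sum θ hJ,
    ← Equiv.sum_comp (Equiv.mulRight x) fun y => thetaFn θ J lam (y * g * y⁻¹)]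
  congr 1
  refine Finset.sum_congr rfl fun y _ => congrArg (thetaFn θ J lam) ?_
  simp [mul_assoc]

/-- Frobenius reciprocity for a class function `ψ`. -/
theorem innerG_indFun {G : Type} [Group G] [Fintype G] (H : Subgroup G) (φ ψ : G → ℂ)
    (hψ : ∀ x g, ψ (x * g * x⁻¹) = ψ g) :
    innerG G (indFun H fun x => φ x) ψ =
      (Nat.card H : ℂ)⁻¹ * ∑ g : G, if g ∈ H then φ g * (starRingEnd ℂ) (ψ g) else 0 := by
  have hG : (Nat.card G : ℂ) ≠ 0 := by exact_mod_cast Nat.card_pos.ne'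
  have h1 : ∀ g : G, indFun H (fun x => φ x) g * (starRingEnd ℂ) (ψ g) = (Nat.card H : ℂ)⁻¹ *
      ∑ x : G, if x * g * x⁻¹ ∈ H then φ (x * g * x⁻¹) *
        (starRingEnd ℂ) (ψ (x * g * x⁻¹)) else 0 := by
    intro g
    rw [indFun, finsum_eq_sum_of_fintype, mul_assoc, Finset.sum_mul]
    congr 1
    refine Finset.sum_congr rfl fun x _ => ?_
    rw [hψ]
    split_ifs <;> simp
  rw [innerG, finsum_eq_sum_of_fintype, Finset.sum_congr rfl fun g _ => h1 g, ← Finset.mul_sum,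
    Finset.sum_comm]
  have h2 : ∀ x : G, (∑ g : G, if x * g * x⁻¹ ∈ H then φ (x * g * x⁻¹) *
      (starRingEnd ℂ) (ψ (x * g * x⁻¹)) else 0) =
      ∑ g : G, if g ∈ H then φ g * (starRingEnd ℂ) (ψ g) else 0 := fun x =>
    Equiv.sum_comp (MulAut.conj x).toEquiv
      fun g => if g ∈ H then φ g * (starRingEnd ℂ) (ψ g) else 0
  rw [Finset.sum_congr rfl fun x _ => h2 x, Finset.sum_const, Finset.card_univ, nsmul_eq_mul,
    ← Nat.card_eq_fintype_card]
  field_simp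

theorem sum_ite_mem_addChar (θ : AddChar F ℂ) (hθ : θ ≠ 1) {l J : NonUnitalSubalgebra F R}
    (h : l ≤ J) (nu : ↥J →ₗ[F] F) :
    (∑ X : ↥J, if (X : R) ∈ l then θ (nu X) else 0) =
      if resTo h nu = 0 then (Nat.card ↥l : ℂ) else 0 := by
  rw [← sum_addChar_linear θ hθ (resTo h nu)]
  symm
  refine Finset.sum_of_injOn (inclMap h) (inclMap_injective h).injOn (fun _ _ => by simp) ?_ ?_
  · intro X _ hX
    exact if_neg fun hXl => hX ⟨⟨X, hXl⟩, by simp, rfl⟩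
  · intro Y _
    exact (if_pos Y.2).symm

theorem innerG_indFun_kirillov (θ : AddChar F ℂ) (hθ : θ ≠ 1) {l J : NonUnitalSubalgebra F R}
    (hJ : IsNil J) (h : l ≤ J) (lam lam' : ↥J →ₗ[F] F) :
    innerG ↥(algGroup F R J) (indFun (algSubgroup l J) fun x => thetaFn θ J lam x)
        (kirillov θ J lam') =
      (Real.sqrt (Nat.card (coOrbit J lam')) : ℂ) / (Nat.card ↥J : ℂ) *
        Nat.card {x : ↥(algGroup F R J) | resTo h (coAct x lam') = resTo h lam} := by
  have hl0 : (Nat.card ↥l : ℂ) ≠ 0 := by exact_mod_cast Nat.card_pos.ne'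
  rw [innerG_indFun _ _ _ (kirillov_conj θ hJ lam'), card_algSubgroup h (hJ.mono h)]
  set C : ℂ := (Real.sqrt (Nat.card (coOrbit J lam')) : ℂ) / (Nat.card ↥J : ℂ) with hC
  have h1 : ∀ g : ↥(algGroup F R J), (if g ∈ algSubgroup l J then
      thetaFn θ J lam g * (starRingEnd ℂ) (kirillov θ J lam' g) else 0) =
      C * ∑ x : ↥(algGroup F R J),
        if (gElt g : R) ∈ l then θ ((lam - coAct x lam') (gElt g)) else 0 := by
    intro g
    simp only [mem_algSubgroup_iff (hJ.mono h)]
    split_ifs with hg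
    · rw [kirillov_eq_sum θ hJ, map_mul, map_sum, mul_left_comm, ← hC, Finset.mul_sum]
      congr 1
      · simp [hC]
      · refine Finset.sum_congr rfl fun x _ => ?_
        rw [thetaFn_conj, ← AddChar.map_neg_eq_conj, thetaFn, ← AddChar.map_add_eq_mul,
          ← sub_eq_add_neg]
        rfl
    · simp
  have h2 : ∀ x : ↥(algGroup F R J), (∑ g : ↥(algGroup F R J),
      if (gElt g : R) ∈ l then θ ((lam - coAct x lam') (gElt g)) else 0) =
      if resTo h (coAct x lam') = resTo h lam then (Nat.card ↥l : ℂ) else 0 := by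
    intro x
    have h3 := Equiv.sum_comp (gEltEquiv hJ)
      fun X => if (X : R) ∈ l then θ ((lam - coAct x lam') X) else 0
    rw [sum_ite_mem_addChar θ hθ h] at h3
    refine h3.trans (if_congr ?_ rfl rfl)
    rw [eq_comm (a := resTo h (coAct x lam')), ← sub_eq_zero (a := resTo h lam)]
    rfl
  rw [Finset.sum_congr rfl fun g _ => h1 g, ← Finset.mul_sum, Finset.sum_comm,
    Finset.sum_congr rfl fun x _ => h2 x, Finset.sum_ite, Finset.sum_const, Finset.sum_const_zero,
    add_zero, nsmul_eq_mul, Nat.card_eq_fintype_card (α := ↥{x : ↥(algGroup F R J) | _}),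
    Fintype.card_subtype]
  field_simp
  simp

theorem IsOrthPair.exists_innerG_eq {J s l : NonUnitalSubalgebra F R} {lam lam' : ↥J →ₗ[F] F}
    (h : IsOrthPair J lam s l) (h' : IsOrthPair J lam' s l) (hJ : IsNil J) (θ : AddChar F ℂ)
    (hθ : θ ≠ 1) (hres : ∀ y ∈ l, lamE J lam' y = lamE J lam y) :
    ∃ k : ℕ, 0 < k ∧ innerG ↥(algGroup F R J)
      (indFun (algSubgroup l J) fun x => thetaFn θ J lam x) (kirillov θ J lam') = (k : ℂ) := by
  have hlJ := h.l_le.trans h.s_le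
  have hs := hJ.mono h.s_le
  have hJ0 : (Nat.card ↥J : ℂ) ≠ 0 := by exact_mod_cast Nat.card_pos.ne'
  rw [innerG_indFun_kirillov θ hθ hJ hlJ]
  set A : Set ↥(algGroup F R J) := {x | resTo hlJ (coAct x lam') = resTo hlJ lam}
  have hA : ∀ a ∈ A, ∀ t ∈ algSubgroup s J, a * t ∈ A := by
    intro a ha t ht
    refine LinearMap.ext fun y => ?_
    obtain ⟨hy, h2⟩ := h.lamE_conj y.2 ht.1 ht.2
    rw [coAct_mul]
    refine (DFunLike.congr_fun ha ⟨_, hy⟩).trans ?_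
    rwa [lamE_apply J lam (hlJ hy), lamE_apply J lam (hlJ y.2)] at h2
  have hone : (1 : ↥(algGroup F R J)) ∈ A := by
    refine LinearMap.ext fun y => ?_
    rw [coAct_one]
    have h2 := hres y y.2
    rwa [lamE_apply J lam (hlJ y.2), lamE_apply J lam' (hlJ y.2)] at h2
  obtain ⟨m, hm⟩ := card_subgroup_dvd_card_of_mul_mem _ A hA
  rw [card_algSubgroup h.s_le hs] at hm
  have hApos : 0 < Nat.card A := Nat.card_pos_iff.2 ⟨⟨1, hone⟩, inferInstance⟩
  obtain ⟨n, hn, hn2⟩ := exists_card_coOrbit_eq_mul_self hs (resTo h'.s_le lam')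
  have hsq := h'.sqrt_card_coOrbit_mul hJ
  rw [hn2, Nat.cast_mul, Real.sqrt_mul_self (Nat.cast_nonneg n), Complex.ofReal_natCast] at hsq
  refine ⟨m * n, Nat.mul_pos (Nat.pos_of_ne_zero ?_) hn, ?_⟩
  · rintro rfl
    omega
  · rw [hm, Nat.cast_mul, ← mul_assoc, div_mul_eq_mul_div, hsq]
    push_cast
    field_simp

/-! ### The terminal subalgebras of the chains -/

section Chains

variable (J : NonUnitalSubalgebra F R) (lam : ↥J →ₗ[F] F)

theorem sChain_antitone : Antitone (sChain J lam) :=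
  antitone_nat_of_succ_le fun _ => sStep_le J lam _ _

theorem lChain_monotone : Monotone (lChain J lam) :=
  monotone_nat_of_le_succ fun n _ hy =>
    ⟨⟨hy.1, fun z hz => hy.2 z hz.1⟩, fun w hw => hy.2 w (sChain_antitone J lam n.le_succ hw)⟩

theorem sChain_succ_eq_or_card_le (n : ℕ) : sChain J lam (n + 1) = sChain J lam n ∨
    (sChain J lam (n + 1) : Set R).ncard + (n + 1) ≤ Fintype.card R := by
  have hlt : ∀ n, sChain J lam (n + 1) ≠ sChain J lam n →
      (sChain J lam (n + 1) : Set R).ncard < (sChain J lam n : Set R).ncard := fun n hn =>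
    Set.ncard_lt_ncard (SetLike.coe_ssubset_coe.2
      (lt_of_le_of_ne (sChain_antitone J lam n.le_succ) hn)) (Set.toFinite _)
  induction n with
  | zero =>
    refine or_iff_not_imp_left.2 fun h => (hlt 0 h).trans_le ?_
    rw [← Nat.card_eq_fintype_card]
    exact Set.ncard_le_card _
  | succ n ih =>
    refine or_iff_not_imp_left.2 fun h => ?_
    have h1 := hlt (n + 1) h
    rcases ih with ih | ih
    · have ih' : sChainAux J lam (n + 1) = sChainAux J lam n := Subtype.ext ih
      refine absurd ?_ h
      change sStep J lam (sChainAux J lam (n + 1)).1 _ = sStep J lam (sChainAux J lam n).1 _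
      simp only [ih']
    · omega

theorem sChain_card_succ : sChain J lam (Fintype.card R + 1) = sbar J lam := by
  rcases sChain_succ_eq_or_card_le J lam (Fintype.card R) with h | h
  · exact h
  · omega

variable {J lam}

theorem mul_eq_zero_of_mem_sbar {x y : R} (hx : x ∈ sbar J lam) (hy : y ∈ lbar J lam) :
    lamE J lam (x * y) = 0 := by
  rw [← sChain_card_succ] at hx
  exact hx.2 y hy

theorem mem_sbar_of_forall {x : R} (hx : x ∈ J) (h : ∀ i, x ∈ sChain J lam i →
    ∀ y ∈ lChain J lam i, y ∈ lbar J lam → sbar J lam ≤ sChain J lam i →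
      lamE J lam (x * y) = 0) : x ∈ sbar J lam := by
  have key : ∀ i ≤ Fintype.card R, x ∈ sChain J lam i := by
    intro i
    induction i with
    | zero => exact fun _ => hx
    | succ i ih =>
      intro hi
      have hi' := (Nat.le_succ i).trans hi
      exact ⟨ih hi', fun y hy => h i (ih hi') y hy (lChain_monotone J lam hi' hy)
        (sChain_antitone J lam hi')⟩
  exact key _ le_rfl

theorem lChain_mul_mem {i : ℕ} {y z : R} (hy : y ∈ lChain J lam i) (hz : z ∈ sChain J lam i) :
    y * z ∈ lChain J lam i := by
  refine ⟨mul_mem hy.1 hz, fun w hw => ?_⟩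
  rw [mul_assoc]
  exact hy.2 (z * w) (mul_mem hz hw)

theorem sbar_mul_lbar_mem {x y : R} (hx : x ∈ sbar J lam) (hy : y ∈ lbar J lam) :
    x * y ∈ lbar J lam := by
  refine ⟨mul_mem hx hy.1, fun w hw => ?_⟩
  rw [mul_assoc]
  exact mul_eq_zero_of_mem_sbar hx (lChain_mul_mem hy hw)

theorem mem_sbar_iff {x : R} (hx : x ∈ J) :
    x ∈ sbar J lam ↔ ∀ y ∈ lbar J lam, lamE J lam (x * y) = 0 :=
  ⟨fun h _ hy => mul_eq_zero_of_mem_sbar h hy,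
    fun h => mem_sbar_of_forall hx fun _ _ y _ hy _ => h y hy⟩

theorem lamE_rightAct (u : ↥(algGroup F R J)) {x : R} (hx : x ∈ J) :
    lamE J (rightAct u lam) x = lamE J lam (x * (((u : Rˣ)⁻¹ : Rˣ) : R)) := by
  rw [lamE_apply J _ hx]
  exact (lamE_apply J lam (mul_coe_mem u⁻¹ hx)).symm

theorem lamE_rightAct_of_mem_lbar {u : ↥(algGroup F R J)} (hu : u ∈ Sbarg J lam) {y : R}
    (hy : y ∈ lbar J lam) : lamE J (rightAct u lam) y = lamE J lam y := by
  have hy' : y * ((((u : Rˣ)⁻¹ : Rˣ) : R) - 1) ∈ J :=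
    mul_mem (lbar_le J lam hy) (sbar_le J lam hu.2)
  have h : y * (((u : Rˣ)⁻¹ : Rˣ) : R) = y * ((((u : Rˣ)⁻¹ : Rˣ) : R) - 1) + y := by
    noncomm_ring
  rw [lamE_rightAct u (lbar_le J lam hy), h, lamE_add J lam hy' (lbar_le J lam hy),
    show lamE J lam (y * ((((u : Rˣ)⁻¹ : Rˣ) : R) - 1)) = 0 from hy.2 _ hu.2, zero_add]

theorem isOrthPair_rightAct {u : ↥(algGroup F R J)} (hu : u ∈ Sbarg J lam) :
    IsOrthPair J (rightAct u lam) (sbar J lam) (lbar J lam) := by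
  have hsJ := sbar_le J lam
  have hl := lStep_le J lam (sbar J lam) hsJ
  have hright : ∀ y ∈ lbar J lam, ∀ x ∈ sbar J lam, y * x ∈ lbar J lam := fun y hy x hx =>
    lChain_mul_mem (i := Fintype.card R) hy hx
  refine ⟨hsJ, hl, fun x hx y hy => sbar_mul_lbar_mem hx hy, hright, fun x hx y hy => ?_,
    fun y hy x hx => ?_, fun x hx h => ?_⟩
  · rw [lamE_rightAct_of_mem_lbar hu (sbar_mul_lbar_mem hx hy), mul_eq_zero_of_mem_sbar hx hy]
  · rw [lamE_rightAct_of_mem_lbar hu (hright y hy x hx), hy.2 x hx]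
  · refine mem_sbar_of_forall hx fun i hi y hyi hy hsi => ?_
    let v : ↥(algGroup F R (sChain J lam i)) := ⟨u, algGroup_mono hsi hu⟩
    have hyu : y * ((u : Rˣ) : R) ∈ lbar J lam := by
      have e : y * ((u : Rˣ) : R) = y * (((u : Rˣ) : R) - 1) + y := by noncomm_ring
      exact e ▸ add_mem (hright y hy _ hu.1) hy
    have h1 : ((u : Rˣ) : R) * (x * (((u : Rˣ)⁻¹ : Rˣ) : R)) ∈ sChain J lam i :=
      coe_mul_mem v (mul_coe_mem v⁻¹ hi)
    have h2 := h _ hyu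
    rw [lamE_rightAct u (mul_mem (lbar_le J lam hyu) hx),
      lamE_rightAct u (mul_mem hx (lbar_le J lam hyu))] at h2
    have e1 : x * (y * ((u : Rˣ) : R)) * (((u : Rˣ)⁻¹ : Rˣ) : R) = x * y := by
      simp [mul_assoc]
    have e2 : y * ((u : Rˣ) : R) * x * (((u : Rˣ)⁻¹ : Rˣ) : R) =
        y * (((u : Rˣ) : R) * (x * (((u : Rˣ)⁻¹ : Rˣ) : R))) := by
      simp only [mul_assoc]
    rw [e1, e2] at h2
    rw [← h2]
    exact hyi.2 _ h1

theorem rightAct_one : rightAct 1 lam = lam := by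
  ext X
  simp [rightAct, rmulMap]

theorem isOrthPair_self : IsOrthPair J lam (sbar J lam) (lbar J lam) := by
  simpa only [rightAct_one] using isOrthPair_rightAct (lam := lam) (one_mem (Sbarg J lam))

theorem rightAct_rightAct (g h : ↥(algGroup F R J)) :
    rightAct g (rightAct h lam) = rightAct (h * g) lam := by
  ext X
  simp [rightAct, rmulMap, mul_assoc]

theorem resTo_rightAct {s : NonUnitalSubalgebra F R} (h : s ≤ J) (t : ↥(algGroup F R s)) :
    resTo h (rightAct (algIncl h t) lam) = rightAct t (resTo h lam) :=
  rfl

/-- Functionals on `J` vanishing on the terminal `s` have the form `X ↦ λ(XY)` with `Y` in the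
terminal `l`. -/
theorem exists_forall_eq_lamE_mul {nu : Module.Dual F ↥J}
    (hnu : resTo (sbar_le J lam) nu = 0) :
    ∃ y ∈ lbar J lam, ∀ X : ↥J, nu X = lamE J lam ((X : R) * y) := by
  let B : ↥(lbar J lam) →ₗ[F] Module.Dual F ↥J :=
    ((LinearMap.mul F ↥J).compr₂ lam).flip.comp (inclMap (lbar_le J lam))
  have hB : ∀ y X, B y X = lamE J lam ((X : R) * y) := fun y X =>
    (lamE_apply J lam (mul_mem X.2 (lbar_le J lam y.2))).symm
  have h := range_eq_dualAnnihilator_of_forall_mem B (subOf (sbar_le J lam)) fun X => by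
    rw [mem_subOf, mem_sbar_iff X.2]
    simp only [hB, Subtype.forall]
  have h1 : nu ∈ (subOf (sbar_le J lam)).dualAnnihilator := by
    rw [Submodule.mem_dualAnnihilator]
    rintro _ ⟨x, rfl⟩
    exact DFunLike.congr_fun hnu x
  rw [← h] at h1
  obtain ⟨y, rfl⟩ := h1
  exact ⟨y, y.2, hB y⟩

theorem resTo_mem_rightOrbit_iff (hJ : IsNil J) (lam' : ↥J →ₗ[F] F) :
    resTo (sbar_le J lam) lam' ∈ rightOrbit (sbar J lam) (resTo (sbar_le J lam) lam) ↔
      lam' ∈ rightOrbitUnder J (Sbarg J lam) lam := by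
  have hs := sbar_le J lam
  have hl := lStep_le J lam (sbar J lam) hs
  constructor
  · rintro ⟨t, ht⟩
    have ht' : resTo hs (rightAct (algIncl hs t)⁻¹ lam' - lam) = 0 := by
      have h1 : resTo hs (rightAct (algIncl hs t)⁻¹ lam') = resTo hs lam := by
        rw [← map_inv, resTo_rightAct, ← ht]
        change rightAct t⁻¹ (rightAct t (resTo hs lam)) = _
        rw [rightAct_rightAct, mul_inv_cancel, rightAct_one]
      rw [resTo, LinearMap.sub_comp]
      exact sub_eq_zero.2 h1
    obtain ⟨y, hy, hnu⟩ := exists_forall_eq_lamE_mul ht'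
    obtain ⟨w, hw⟩ := gElt_surjective (hJ.mono (lbar_le J lam)) ⟨y, hy⟩
    have hw' : ((w : Rˣ) : R) = y + 1 :=
      sub_eq_iff_eq_add.1 (congrArg (fun Y : ↥(lbar J lam) => (Y : R)) hw)
    have h2 : rightAct (algIncl hs t)⁻¹ lam' = rightAct (algIncl (lbar_le J lam) w)⁻¹ lam := by
      refine LinearMap.ext fun X => ?_
      have hXy : (X : R) * y ∈ J := mul_mem X.2 (lbar_le J lam hy)
      have h3 := lamE_rightAct (lam := lam) (algIncl (lbar_le J lam) w)⁻¹ X.2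
      rw [lamE_apply J _ X.2, Subgroup.coe_inv, inv_inv] at h3
      refine (sub_eq_iff_eq_add.1 (hnu X)).trans (Eq.trans ?_ h3.symm)
      rw [← lamE_apply J lam X.2, ← lamE_add J lam hXy X.2]
      congr 1
      change _ = (X : R) * ((w : Rˣ) : R)
      rw [hw', mul_add, mul_one]
    refine ⟨(algIncl (lbar_le J lam) w)⁻¹ * algIncl hs t, ?_, ?_⟩
    · exact mul_mem (inv_mem (algGroup_mono hl w.2)) t.2
    · rw [← rightAct_rightAct, ← h2, rightAct_rightAct, inv_mul_cancel, rightAct_one]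
  · rintro ⟨u, hu, rfl⟩
    exact ⟨⟨u, hu⟩, rfl⟩

end Chains

theorem statement7 (F : Type) [Field F] [Fintype F]
    (R : Type) [Ring R] [Algebra F R] [Fintype R]
    (J : NonUnitalSubalgebra F R) (hJ : IsNil J)
    (θ : AddChar F ℂ) (hθ : θ ≠ 1)
    (lam lam' : ↥J →ₗ[F] F) :
    (resTo (sbar_le J lam) lam' ∈ rightOrbit (sbar J lam) (resTo (sbar_le J lam) lam) ↔
      lam' ∈ rightOrbitUnder J (Sbarg J lam) lam) ∧
    (lam' ∈ rightOrbitUnder J (Sbarg J lam) lam →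
      indFun (Sbarg J lam)
          (fun x => kirillov θ (sbar J lam) (resTo (sbar_le J lam) lam') (toAlg x)) =
        kirillov θ J lam' ∧
      ∃ k : ℕ, 0 < k ∧
        innerG ↥(algGroup F R J) (xi θ J lam) (kirillov θ J lam') = (k : ℂ)) := by
  refine ⟨resTo_mem_rightOrbit_iff hJ lam', ?_⟩
  rintro ⟨u, hu, rfl⟩
  exact ⟨(isOrthPair_rightAct hu).indFun_kirillov hJ θ hθ,
    isOrthPair_self.exists_innerG_eq (isOrthPair_rightAct hu) hJ θ hθ fun _ hy =>
      lamE_rightAct_of_mem_lbar hu hy⟩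

end IterChar
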